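/- Let N ≥ 1 be an integer and u ∈ H^{1/2}₊(S¹). Then the shifted Hankel operator K_u has rank exactly N if and only if u is (the boundary value on S¹ of) a rational function A(z)/B(z) where A, B are complex polynomials of degree at most N, A and B have no common factors, deg A = N or deg B = N, and B has no zeros in the closed unit disc. -/

import Mathlib

open Complex Filter
open scoped ComplexConjugate Topology ENNReal

noncomputable section

/-- ℓ²(ℕ, ℂ): the sequence model of the Hardy space L²₊(S¹), identifying a function
with its sequence of nonnegative Fourier coefficients. -/
abbrev Hardy : Type := lp (fun _ : ℕ => ℂ) 2

/-- A coefficient sequence belongs to L²₊. -/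
def MemL2 (u : ℕ → ℂ) : Prop := Memℓp u 2

/-- A coefficient sequence belongs to the Sobolev space H^s₊. -/
def MemHs (s : ℝ) (u : ℕ → ℂ) : Prop :=
  Summable fun n : ℕ => ((1 : ℝ) + (n : ℝ) ^ 2) ^ s * ‖u n‖ ^ 2

/-- The squared H^s norm of a coefficient sequence. -/
def hsNormSq (s : ℝ) (u : ℕ → ℂ) : ℝ :=
  ∑' n : ℕ, ((1 : ℝ) + (n : ℝ) ^ 2) ^ s * ‖u n‖ ^ 2

/-- The L² inner product (f|g), ℂ-linear in the first argument. -/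
def hinner (f g : ℕ → ℂ) : ℂ := ∑' n : ℕ, f n * conj (g n)

/-- The squared L² norm. -/
def l2normSq (f : ℕ → ℂ) : ℝ := ∑' n : ℕ, ‖f n‖ ^ 2

/-- Coefficients of the constant function 1. -/
def oneSeq : ℕ → ℂ := fun n => if n = 0 then 1 else 0

/-- The Hankel operator H_u(h) = Π(u ⬝ conj h) in Fourier coefficients. -/
def hankel (u h : ℕ → ℂ) : ℕ → ℂ := fun k => ∑' ℓ : ℕ, u (k + ℓ) * conj (h ℓ)

/-- The shifted Hankel operator K_u = T_z^* ∘ H_u in Fourier coefficients. -/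
def khankel (u h : ℕ → ℂ) : ℕ → ℂ := fun k => ∑' ℓ : ℕ, u (k + 1 + ℓ) * conj (h ℓ)

/-- H_u². -/
def hu2 (u h : ℕ → ℂ) : ℕ → ℂ := hankel u (hankel u h)

/-- K_u². -/
def ku2 (u h : ℕ → ℂ) : ℕ → ℂ := khankel u (khankel u h)

/-- The m-th Fourier coefficient of |u|², m ∈ ℤ. -/
def absSqCoeff (u : ℕ → ℂ) (m : ℤ) : ℂ :=
  ∑' q : ℕ × ℕ, if ((q.1 : ℤ) - (q.2 : ℤ) = m) then u q.1 * conj (u q.2) else 0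

/-- The Toeplitz operator T_{|u|²} in Fourier coefficients. -/
def toeplitzAbsSq (u h : ℕ → ℂ) : ℕ → ℂ :=
  fun k => ∑' ℓ : ℕ, absSqCoeff u ((k : ℤ) - (ℓ : ℤ)) * h ℓ

/-- Fourier coefficients of Π(|u|²u). -/
def cubic (u : ℕ → ℂ) : ℕ → ℂ := fun n =>
  ∑' q : ℕ × ℕ × ℕ, if q.1 + q.2.2 = q.2.1 + n then u q.1 * conj (u q.2.1) * u q.2.2 else 0

/-- `u : ℝ → (ℕ → ℂ)` solves the α-Szegő equation i ∂ₜ u = Π(|u|²u) + α(u|1),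
written coefficientwise on nonnegative Fourier modes. -/
def SolvesSzego (α : ℝ) (u : ℝ → ℕ → ℂ) : Prop :=
  ∀ n t, HasDerivAt (fun τ => u τ n)
    (-Complex.I * (cubic (u t) n + (α : ℂ) * u t 0 * oneSeq n)) t

/-- `u` is a smooth curve valued in H^s₊. -/
def SmoothHsCurve (s : ℝ) (u : ℝ → ℕ → ℂ) : Prop :=
  (∀ t, MemHs s (u t)) ∧ ∀ n, ContDiff ℝ (⊤ : ℕ∞) fun t => u t n

/-- `u` is a continuous curve valued in H^s₊. -/
def ContHsCurve (s : ℝ) (u : ℝ → ℕ → ℂ) : Prop :=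
  (∀ t, MemHs s (u t)) ∧
    ∀ t₀ : ℝ, Tendsto (fun t => hsNormSq s (fun n => u t n - u t₀ n)) (𝓝 t₀) (𝓝 0)

/-- E_u(τ) = ker(H_u² − τ² I) as a subset of ℓ². -/
def Espace (u : ℕ → ℂ) (τ : ℝ) : Set (ℕ → ℂ) :=
  {h | MemL2 h ∧ hu2 u h = ((τ : ℂ) ^ 2) • h}

/-- F_u(τ) = ker(K_u² − τ² I) as a subset of ℓ². -/
def Fspace (u : ℕ → ℂ) (τ : ℝ) : Set (ℕ → ℂ) :=
  {h | MemL2 h ∧ ku2 u h = ((τ : ℂ) ^ 2) • h}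

/-- Σ_H(u): τ > 0 such that E_u(τ) is not orthogonal to u. -/
def SigmaH (u : ℕ → ℂ) : Set ℝ :=
  {τ : ℝ | 0 < τ ∧ ∃ v ∈ Espace u τ, hinner u v ≠ 0}

/-- Σ_K(u): τ ≥ 0 such that F_u(τ) is not orthogonal to u. -/
def SigmaK (u : ℕ → ℂ) : Set ℝ :=
  {τ : ℝ | 0 ≤ τ ∧ ∃ v ∈ Fspace u τ, hinner u v ≠ 0}

/-- `p` is the orthogonal projection of `w` on the subspace `V` of ℓ². -/
def IsOrthProj (V : Set (ℕ → ℂ)) (w p : ℕ → ℂ) : Prop :=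
  p ∈ V ∧ ∀ v ∈ V, hinner (w - p) v = 0

/-- The rank of the shifted Hankel operator K_u. -/
def kuRank (u : ℕ → ℂ) : Cardinal :=
  Module.rank ℂ (Submodule.span ℂ (khankel u '' {h | MemL2 h}))

/-- The rank of the Hankel operator H_u. -/
def huRank (u : ℕ → ℂ) : Cardinal :=
  Module.rank ℂ (Submodule.span ℂ (hankel u '' {h | MemL2 h}))

/-- ℒ(N) : rank K_u = N. -/
def InLN (N : ℕ) (u : ℕ → ℂ) : Prop := MemL2 u ∧ kuRank u = N

/-- The constant function 1 as an element of ℓ². -/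
def oneH : Hardy := lp.single 2 0 1


/-- The backward shift on sequences. -/
def bshift : (ℕ → ℂ) →ₗ[ℂ] (ℕ → ℂ) := LinearMap.funLeft ℂ ℂ Nat.succ

/-- The linear map `P ↦ P(S)w`, where `S` is the backward shift. -/
def orbitMap (w : ℕ → ℂ) : Polynomial ℂ →ₗ[ℂ] (ℕ → ℂ) :=
  (LinearMap.applyₗ w).comp (Polynomial.aeval bshift).toLinearMap

/-- `U` is a quotient of polynomials of degree at most `M`. -/
def IsRatioOfDegreeLE (U : PowerSeries ℂ) (M : ℕ) : Prop :=
  ∃ A B : Polynomial ℂ, B ≠ 0 ∧ A.natDegree ≤ M ∧ B.natDegree ≤ M ∧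
    (B : PowerSeries ℂ) * U = A

lemma orbitMap_apply (w : ℕ → ℂ) (P : Polynomial ℂ) :
    orbitMap w P = Polynomial.aeval bshift P w := rfl

lemma bshift_pow_apply (k : ℕ) (w : ℕ → ℂ) (n : ℕ) : (bshift ^ k) w n = w (n + k) := by
  induction k generalizing n with
  | zero => simp
  | succ k ih =>
    rw [pow_succ', Module.End.mul_apply]
    change (bshift ^ k) w (n + 1) = _
    rw [ih]
    congr 1
    omega

lemma orbitMap_X_pow (w : ℕ → ℂ) (k n : ℕ) :
    orbitMap w (Polynomial.X ^ k) n = w (n + k) := by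
  simp [orbitMap_apply, bshift_pow_apply]

lemma coeff_reflect_mul (u : ℕ → ℂ) (M n : ℕ) (P : Polynomial ℂ) (hP : P.natDegree ≤ M) :
    PowerSeries.coeff (n + 1 + M)
      (((P.reflect M : Polynomial ℂ) : PowerSeries ℂ) * PowerSeries.mk u) =
      orbitMap (fun k => u (k + 1)) P n := by
  refine Polynomial.induction_with_natDegree_le (fun P => PowerSeries.coeff (n + 1 + M)
    (((P.reflect M : Polynomial ℂ) : PowerSeries ℂ) * PowerSeries.mk u) =
      orbitMap (fun k => u (k + 1)) P n) M ?_ ?_ ?_ P hP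
  · simp
  · intro k r _ hk
    have h : n + 1 + M - (M - k) = n + k + 1 := by omega
    rw [Polynomial.reflect_C_mul_X_pow, Polynomial.revAt_le hk, ← Polynomial.smul_eq_C_mul,
      ← Polynomial.smul_eq_C_mul, map_smul, Pi.smul_apply, orbitMap_X_pow]
    simp only [Polynomial.coe_smul, Polynomial.coe_pow, Polynomial.coe_X, smul_mul_assoc, map_smul]
    rw [PowerSeries.coeff_X_pow_mul', if_pos (by omega), PowerSeries.coeff_mk, h]
  · intro f g _ _ hf hg
    rw [Polynomial.reflect_add, Polynomial.coe_add, add_mul, map_add, hf, hg, map_add,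
      Pi.add_apply]

lemma isRatioOfDegreeLE_iff (u : ℕ → ℂ) (M : ℕ) :
    IsRatioOfDegreeLE (PowerSeries.mk u) M ↔
      ∃ P : Polynomial ℂ, P ≠ 0 ∧ P.natDegree ≤ M ∧ orbitMap (fun k => u (k + 1)) P = 0 := by
  constructor
  · rintro ⟨A, B, hB, hA, hBM, h⟩
    have hd : (B.reflect M).natDegree ≤ M :=
      Polynomial.natDegree_reflect_le.trans (max_le le_rfl hBM)
    refine ⟨B.reflect M, by simpa using hB, hd, ?_⟩
    ext n
    rw [← coeff_reflect_mul u M n _ hd, Polynomial.reflect_reflect, h, Polynomial.coeff_coe,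
      Polynomial.coeff_eq_zero_of_natDegree_lt (by omega)]
    rfl
  · rintro ⟨P, hP, hd, h⟩
    refine ⟨PowerSeries.trunc (M + 1)
        (((P.reflect M : Polynomial ℂ) : PowerSeries ℂ) * PowerSeries.mk u),
      P.reflect M, by simpa using hP, Nat.lt_succ_iff.1 (PowerSeries.natDegree_trunc_lt _ _),
      Polynomial.natDegree_reflect_le.trans (max_le le_rfl hd), ?_⟩
    ext n
    rw [Polynomial.coeff_coe, PowerSeries.coeff_trunc]
    split_ifs with hn
    · rfl
    · obtain ⟨m, rfl⟩ : ∃ m, n = m + 1 + M := ⟨n - 1 - M, by omega⟩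
      rw [coeff_reflect_mul u M m P hd, h]
      rfl

lemma rank_range_orbitMap_le_iff (w : ℕ → ℂ) (M : ℕ) :
    Module.rank ℂ (LinearMap.range (orbitMap w)) ≤ M ↔
      ∃ P : Polynomial ℂ, P ≠ 0 ∧ P.natDegree ≤ M ∧ orbitMap w P = 0 := by
  have hdeg (n : ℕ) : Module.rank ℂ (Polynomial.degreeLT ℂ n) = n := by
    rw [(Polynomial.degreeLTEquiv ℂ n).rank_eq]
    simp
  constructor
  · intro h
    by_contra! hP
    let f := (orbitMap w).rangeRestrict.comp (Polynomial.degreeLT ℂ (M + 1)).subtype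
    have hf : Function.Injective f := by
      rw [← LinearMap.ker_eq_bot, LinearMap.ker_eq_bot']
      rintro ⟨P, hPM⟩ h0
      by_contra hne
      have hP0 : P ≠ 0 := fun h => hne (by simp [h])
      refine hP P hP0 ?_ (congrArg Subtype.val h0)
      rw [Polynomial.mem_degreeLT, Polynomial.degree_eq_natDegree hP0] at hPM
      exact Nat.lt_succ_iff.1 (by exact_mod_cast hPM)
    have := (LinearMap.rank_le_of_injective f hf).trans h
    rw [hdeg] at this
    have : M + 1 ≤ M := by exact_mod_cast this
    omega
  · rintro ⟨P, hP, hd, h⟩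
    have hle : LinearMap.range (orbitMap w) ≤ (Polynomial.degreeLT ℂ M).map (orbitMap w) := by
      rintro _ ⟨Q, rfl⟩
      refine ⟨Q % P, ?_, ?_⟩
      · rw [SetLike.mem_coe, Polynomial.mem_degreeLT]
        refine (Polynomial.degree_mod_lt Q hP).trans_le ?_
        exact Polynomial.natDegree_le_iff_degree_le.1 hd
      · conv_rhs => rw [← EuclideanDomain.mod_add_div Q P, map_add]
        rw [orbitMap_apply w (P * _), mul_comm, map_mul, Module.End.mul_apply,
          ← orbitMap_apply w P, h, map_zero, add_zero]
    calc _ ≤ _ := Submodule.rank_mono hle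
      _ ≤ _ := rank_map_le _ _
      _ = M := hdeg M

lemma MemHs.memL2 {s : ℝ} (hs : 0 ≤ s) {u : ℕ → ℂ} (hu : MemHs s u) : MemL2 u := by
  refine memℓp_gen (hu.of_nonneg_of_le (fun n => by positivity) fun n => ?_)
  have h : (1 : ℝ) ≤ (1 + (n : ℝ) ^ 2) ^ s :=
    Real.one_le_rpow (le_add_of_nonneg_right (by positivity)) hs
  simpa using le_mul_of_one_le_left (sq_nonneg ‖u n‖) h

lemma MemL2.summable_sq {u : ℕ → ℂ} (hu : MemL2 u) : Summable fun n => ‖u n‖ ^ 2 := by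
  simpa using Memℓp.summable (by simp) hu

lemma MemL2.tendsto_zero {u : ℕ → ℂ} (hu : MemL2 u) : Tendsto u atTop (𝓝 0) := by
  have h := hu.summable_sq.tendsto_atTop_zero.sqrt
  simp only [Real.sqrt_sq (norm_nonneg _), Real.sqrt_zero] at h
  exact tendsto_zero_iff_norm_tendsto_zero.2 h

lemma summable_mul_pow {u : ℕ → ℂ} (hu : Tendsto u atTop (𝓝 0)) {z : ℂ} (hz : ‖z‖ < 1) :
    Summable fun n => ‖u n * z ^ n‖ := by
  refine summable_of_isBigO_nat (summable_geometric_of_lt_one (norm_nonneg z) hz) ?_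
  have h : u =O[atTop] fun _ => (1 : ℝ) := hu.isBigO_one ℝ
  simpa using h.norm_left.mul (Asymptotics.isBigO_refl (fun n => ‖z‖ ^ n) atTop)

lemma hasSum_khankel {u h : ℕ → ℂ} (hu : MemL2 u) (hh : MemL2 h) :
    HasSum (fun l => conj (h l) • orbitMap (fun k => u (k + 1)) (Polynomial.X ^ l))
      (khankel u h) := by
  rw [Pi.hasSum]
  intro n
  have hs : Summable fun l => u (n + 1 + l) * conj (h l) := by
    have h1 : Summable fun l => ‖u (n + 1 + l)‖ ^ 2 := by
      simpa [add_comm] using (summable_nat_add_iff (n + 1)).2 hu.summable_sq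
    refine Summable.of_norm_bounded (h1.add hh.summable_sq) fun l => ?_
    rw [norm_mul, RCLike.norm_conj]
    nlinarith [sq_nonneg (‖u (n + 1 + l)‖ - ‖h l‖), sq_nonneg ‖u (n + 1 + l)‖, sq_nonneg ‖h l‖]
  change HasSum _ (∑' l, u (n + 1 + l) * conj (h l))
  convert hs.hasSum using 2 with l
  rw [Pi.smul_apply, orbitMap_X_pow, smul_eq_mul, mul_comm]
  congr 2
  omega

lemma range_orbitMap_le (u : ℕ → ℂ) :
    LinearMap.range (orbitMap fun k => u (k + 1)) ≤
      Submodule.span ℂ (khankel u '' {h | MemL2 h}) := by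
  rintro _ ⟨Q, rfl⟩
  induction Q using Polynomial.induction_on' with
  | add p q hp hq => rw [map_add]; exact add_mem hp hq
  | monomial l a =>
    rw [← Polynomial.C_mul_X_pow_eq_monomial, ← Polynomial.smul_eq_C_mul, map_smul]
    refine Submodule.smul_mem _ _ (Submodule.subset_span
      ⟨Pi.single l 1, (lp.single 2 l (1 : ℂ) : Hardy).2, ?_⟩)
    ext n
    rw [orbitMap_X_pow, khankel, tsum_eq_single l]
    · simp [add_right_comm]
    · intro m hm
      simp [hm]

lemma span_khankel_le {u : ℕ → ℂ} (hu : MemL2 u)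
    [FiniteDimensional ℂ (LinearMap.range (orbitMap fun k => u (k + 1)))] :
    Submodule.span ℂ (khankel u '' {h | MemL2 h}) ≤
      LinearMap.range (orbitMap fun k => u (k + 1)) := by
  refine Submodule.span_le.2 ?_
  rintro _ ⟨h, hh, rfl⟩
  refine (Submodule.closed_of_finiteDimensional _).mem_of_tendsto (hasSum_khankel hu hh)
    (Eventually.of_forall fun s => ?_)
  exact sum_mem fun l _ => Submodule.smul_mem _ _ ⟨_, rfl⟩

lemma kuRank_le_iff {u : ℕ → ℂ} (hu : MemL2 u) (M : ℕ) :
    kuRank u ≤ M ↔ IsRatioOfDegreeLE (PowerSeries.mk u) M := by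
  rw [isRatioOfDegreeLE_iff, ← rank_range_orbitMap_le_iff]
  refine ⟨(Submodule.rank_mono (range_orbitMap_le u)).trans, fun h => ?_⟩
  have : FiniteDimensional ℂ (LinearMap.range (orbitMap fun k => u (k + 1))) :=
    Module.rank_lt_aleph0_iff.1 (h.trans_lt (Cardinal.natCast_lt_aleph0))
  exact (Submodule.rank_mono (span_khankel_le hu)).trans h

lemma tendsto_coeff_mul (B : Polynomial ℂ) {U : PowerSeries ℂ}
    (hU : Tendsto (fun n => PowerSeries.coeff n U) atTop (𝓝 0)) :
    Tendsto (fun n => PowerSeries.coeff n ((B : PowerSeries ℂ) * U)) atTop (𝓝 0) := by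
  induction B using Polynomial.induction_on' with
  | add p q hp hq => simpa [add_mul] using hp.add hq
  | monomial k a =>
    rw [← Polynomial.C_mul_X_pow_eq_monomial, ← Polynomial.smul_eq_C_mul]
    rw [← tendsto_add_atTop_iff_nat k]
    simpa [PowerSeries.coeff_X_pow_mul'] using hU.const_mul a

lemma eval_ne_zero_of_mul_eq {U : PowerSeries ℂ}
    (hU : Tendsto (fun n => PowerSeries.coeff n U) atTop (𝓝 0)) {A B : Polynomial ℂ}
    (hAB : IsCoprime A B) (h : (B : PowerSeries ℂ) * U = A) {z : ℂ} (hz : ‖z‖ ≤ 1) :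
    B.eval z ≠ 0 := by
  intro hB
  obtain ⟨C, rfl⟩ := Polynomial.dvd_iff_isRoot.2 hB
  set D : PowerSeries ℂ := (C : PowerSeries ℂ) * U with hD
  have hDt : Tendsto (fun n => PowerSeries.coeff n D) atTop (𝓝 0) := tendsto_coeff_mul C hU
  have hmul : ((Polynomial.X - Polynomial.C z : Polynomial ℂ) : PowerSeries ℂ) * D = A := by
    rw [← h, hD, Polynomial.coe_mul, mul_assoc]
  have hrec : ∀ n, A.natDegree ≤ n →
      PowerSeries.coeff n D = z * PowerSeries.coeff (n + 1) D := by
    intro n hn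
    have := congrArg (PowerSeries.coeff (n + 1)) hmul
    rw [Polynomial.coeff_coe, Polynomial.coeff_eq_zero_of_natDegree_lt (by omega)] at this
    simpa [sub_mul, PowerSeries.coeff_succ_X_mul, sub_eq_zero] using this
  have hmono : Monotone fun n => ‖PowerSeries.coeff (A.natDegree + n) D‖ := by
    refine monotone_nat_of_le_succ fun n => ?_
    rw [hrec _ (by omega), norm_mul]
    exact mul_le_of_le_one_left (norm_nonneg _) hz
  have hzero : ∀ n, A.natDegree ≤ n → PowerSeries.coeff n D = 0 := by
    intro n hn
    obtain ⟨k, rfl⟩ := Nat.exists_eq_add_of_le hn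
    have hlim : Tendsto (fun n => ‖PowerSeries.coeff (A.natDegree + n) D‖) atTop (𝓝 0) := by
      simpa [add_comm] using ((tendsto_add_atTop_iff_nat A.natDegree).2 hDt).norm
    exact norm_le_zero_iff.1 (hmono.ge_of_tendsto hlim k)
  have hpoly : D = (PowerSeries.trunc A.natDegree D : Polynomial ℂ) := by
    ext n
    rw [Polynomial.coeff_coe, PowerSeries.coeff_trunc]
    split_ifs with hn
    · rfl
    · exact hzero n (not_lt.1 hn)
  rw [hpoly, ← Polynomial.coe_mul, Polynomial.coe_inj] at hmul
  have hA : A.eval z = 0 := by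
    rw [← hmul, Polynomial.eval_mul]
    simp
  obtain ⟨a, b, hab⟩ := hAB
  simpa [hA] using congrArg (Polynomial.eval z) hab

lemma tsum_coeff_mul {u : ℕ → ℂ} (hu : Tendsto u atTop (𝓝 0)) (B : Polynomial ℂ) {z : ℂ}
    (hz : ‖z‖ < 1) :
    ∑' n, PowerSeries.coeff n ((B : PowerSeries ℂ) * PowerSeries.mk u) * z ^ n =
      B.eval z * ∑' n, u n * z ^ n := by
  have hsupp : ∀ n ∉ Finset.range (B.natDegree + 1), B.coeff n * z ^ n = 0 := by
    intro n hn
    rw [Polynomial.coeff_eq_zero_of_natDegree_lt (by simpa using hn), zero_mul]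
  have hB : Summable fun n => ‖B.coeff n * z ^ n‖ :=
    summable_of_ne_finset_zero fun n hn => by rw [hsupp n hn, norm_zero]
  rw [Polynomial.eval_eq_sum_range, ← tsum_eq_sum (L := .unconditional ℕ) hsupp,
    tsum_mul_tsum_eq_tsum_sum_antidiagonal_of_summable_norm hB (summable_mul_pow hu hz)]
  refine tsum_congr fun n => ?_
  rw [PowerSeries.coeff_mul, Finset.sum_mul]
  refine Finset.sum_congr rfl fun p hp => ?_
  rw [← Finset.HasAntidiagonal.mem_antidiagonal.1 hp, pow_add, Polynomial.coeff_coe,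
    PowerSeries.coeff_mk]
  ring

lemma eq_zero_of_tsum_eq_zero {d : ℕ → ℂ} (hd : Tendsto d atTop (𝓝 0))
    (h : ∀ z : ℂ, ‖z‖ < 1 → ∑' n, d n * z ^ n = 0) : d = 0 := by
  have hp : HasFPowerSeriesAt (0 : ℂ → ℂ) (FormalMultilinearSeries.ofScalars ℂ d) 0 := by
    rw [hasFPowerSeriesAt_iff]
    filter_upwards [Metric.ball_mem_nhds (0 : ℂ) one_pos] with z hz
    have hz' : ‖z‖ < 1 := by simpa using hz
    have := (summable_mul_pow hd hz').of_norm.hasSum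
    rw [h z hz'] at this
    simpa [FormalMultilinearSeries.coeff_ofScalars, mul_comm] using this
  have h0 := hp.eq_zero
  ext n
  rw [← FormalMultilinearSeries.coeff_ofScalars (𝕜 := ℂ) (p := d) (n := n), h0]
  rfl

lemma mul_mk_eq_iff {u : ℕ → ℂ} (hu : Tendsto u atTop (𝓝 0)) (A B : Polynomial ℂ) :
    (B : PowerSeries ℂ) * PowerSeries.mk u = A ↔
      ∀ z : ℂ, ‖z‖ < 1 → B.eval z * ∑' n, u n * z ^ n = A.eval z := by
  have hA (z : ℂ) : ∑' n, A.coeff n * z ^ n = A.eval z := by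
    rw [Polynomial.eval_eq_sum_range, tsum_eq_sum (s := Finset.range (A.natDegree + 1))]
    intro n hn
    rw [Polynomial.coeff_eq_zero_of_natDegree_lt (by simpa using hn), zero_mul]
  constructor
  · intro h z hz
    rw [← tsum_coeff_mul hu B hz, h, ← hA]
    simp
  · intro h
    have hB : Tendsto (fun n => PowerSeries.coeff n ((B : PowerSeries ℂ) * PowerSeries.mk u))
        atTop (𝓝 0) := tendsto_coeff_mul B (by simpa using hu)
    have hAt : Tendsto A.coeff atTop (𝓝 0) := by
      simpa using tendsto_coeff_mul A (U := 1) (by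
        refine tendsto_const_nhds.congr' ?_
        filter_upwards [eventually_ne_atTop 0] with n hn
        simp [PowerSeries.coeff_one, hn])
    have h0 := eq_zero_of_tsum_eq_zero (by simpa using hB.sub hAt) (fun z hz => by
      simp only [sub_mul]
      rw [(summable_mul_pow hB hz).of_norm.tsum_sub (summable_mul_pow hAt hz).of_norm,
        tsum_coeff_mul hu B hz, hA, h z hz, sub_self])
    ext n
    simpa [sub_eq_zero] using congrFun h0 n

/-- A power series which is a quotient of polynomials of degree at most `N`, but not of smaller
degree, is represented by coprime polynomials, one of which has degree exactly `N`. -/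
lemma IsRatioOfDegreeLE.exists_isCoprime {U : PowerSeries ℂ} {N : ℕ} (hN : 1 ≤ N)
    (h : IsRatioOfDegreeLE U N) (h' : ¬ IsRatioOfDegreeLE U (N - 1)) :
    ∃ A B : Polynomial ℂ, A.natDegree ≤ N ∧ B.natDegree ≤ N ∧ IsCoprime A B ∧
      (A.natDegree = N ∨ B.natDegree = N) ∧ (B : PowerSeries ℂ) * U = A := by
  obtain ⟨A, B, hB, hAN, hBN, hU⟩ := h
  have hg : gcd A B ≠ 0 := gcd_ne_zero_of_right hB
  obtain ⟨A', hA'⟩ := gcd_dvd_left A B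
  obtain ⟨B', hB'⟩ := gcd_dvd_right A B
  have hcop : IsCoprime A' B' := by
    have := isCoprime_div_gcd_div_gcd (p := A) hB
    rwa [← EuclideanDomain.eq_div_of_mul_eq_right hg hA'.symm,
      ← EuclideanDomain.eq_div_of_mul_eq_right hg hB'.symm] at this
  have hB0 : B' ≠ 0 := right_ne_zero_of_mul (hB' ▸ hB)
  have hU' : (B' : PowerSeries ℂ) * U = A' := by
    refine mul_left_cancel₀ (a := ((gcd A B : Polynomial ℂ) : PowerSeries ℂ)) (by simpa using hg) ?_
    rw [← mul_assoc, ← Polynomial.coe_mul, ← Polynomial.coe_mul, ← hA', ← hB', hU]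
  have hA'N : A'.natDegree ≤ N := by
    by_cases hA0 : A' = 0
    · simp [hA0]
    · rw [hA', Polynomial.natDegree_mul hg hA0] at hAN
      omega
  have hB'N : B'.natDegree ≤ N := by
    rw [hB', Polynomial.natDegree_mul hg hB0] at hBN
    omega
  refine ⟨A', B', hA'N, hB'N, hcop, ?_, hU'⟩
  by_contra! hne
  exact h' ⟨A', B', hB0, by omega, by omega, hU'⟩

lemma not_isRatioOfDegreeLE_of_isCoprime {U : PowerSeries ℂ} {A B : Polynomial ℂ} {M N : ℕ}
    (hB : B ≠ 0) (hAB : IsCoprime A B) (hdeg : A.natDegree = N ∨ B.natDegree = N) (hM : M < N)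
    (hU : (B : PowerSeries ℂ) * U = A) : ¬ IsRatioOfDegreeLE U M := by
  rintro ⟨A₁, B₁, hB₁, hA₁M, hB₁M, hU₁⟩
  have h : A * B₁ = A₁ * B := by
    rw [← Polynomial.coe_inj, Polynomial.coe_mul, Polynomial.coe_mul, ← hU, ← hU₁]
    ring
  obtain ⟨C, rfl⟩ : B ∣ B₁ := hAB.symm.dvd_of_dvd_mul_left ⟨A₁, by rw [h, mul_comm]⟩
  have hC : C ≠ 0 := right_ne_zero_of_mul hB₁
  have hA₁ : A₁ = A * C := by
    refine mul_right_cancel₀ hB ?_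
    rw [← h]
    ring
  rw [Polynomial.natDegree_mul hB hC] at hB₁M
  by_cases hA : A = 0
  · subst hA
    simp only [Polynomial.natDegree_zero] at hdeg
    omega
  · rw [hA₁, Polynomial.natDegree_mul hA hC] at hA₁M
    omega

/-- Kronecker-type theorem: `rank K_u = N` iff `u` is a rational
function `A/B` with `A, B ∈ ℂ_N[z]`, `A ∧ B = 1`, `deg A = N` or `deg B = N`, and
`B` has no zero in the closed unit disc. -/
theorem kronecker_rank_shifted_hankel (N : ℕ) (hN : 1 ≤ N) (u : ℕ → ℂ)
    (hu : MemHs (1/2) u) :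
    kuRank u = N ↔
      ∃ A B : Polynomial ℂ, A.natDegree ≤ N ∧ B.natDegree ≤ N ∧ IsCoprime A B ∧
        (A.natDegree = N ∨ B.natDegree = N) ∧
        (∀ z : ℂ, ‖z‖ ≤ 1 → B.eval z ≠ 0) ∧
        (∀ z : ℂ, ‖z‖ < 1 → ∑' n : ℕ, u n * z ^ n = A.eval z / B.eval z) := by
  have hL2 : MemL2 u := hu.memL2 (by norm_num)
  have hlim : Tendsto u atTop (𝓝 0) := hL2.tendsto_zero
  constructor
  · intro h
    obtain ⟨A, B, hA, hB, hAB, hdeg, hU⟩ := ((kuRank_le_iff hL2 N).1 h.le).exists_isCoprime hN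
      fun h' => by
        have h1 := (kuRank_le_iff hL2 (N - 1)).2 h'
        rw [h] at h1
        have : N ≤ N - 1 := by exact_mod_cast h1
        omega
    have hne : ∀ z : ℂ, ‖z‖ ≤ 1 → B.eval z ≠ 0 := fun z hz =>
      eval_ne_zero_of_mul_eq (by simpa using hlim) hAB hU hz
    refine ⟨A, B, hA, hB, hAB, hdeg, hne, fun z hz => ?_⟩
    rw [eq_div_iff (hne z hz.le), mul_comm]
    exact (mul_mk_eq_iff hlim A B).1 hU z hz
  · rintro ⟨A, B, hA, hB, hAB, hdeg, hne, hsum⟩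
    have hB0 : B ≠ 0 := by
      rintro rfl
      exact hne 0 (by simp) (by simp)
    have hU : (B : PowerSeries ℂ) * PowerSeries.mk u = A :=
      (mul_mk_eq_iff hlim A B).2 fun z hz => by
        rw [hsum z hz, mul_div_cancel₀ _ (hne z hz.le)]
    have hle : kuRank u ≤ N := (kuRank_le_iff hL2 N).2 ⟨A, B, hB0, hA, hB, hU⟩
    obtain ⟨M, hM⟩ := Cardinal.lt_aleph0.1 (hle.trans_lt Cardinal.natCast_lt_aleph0)
    have hMN : M ≤ N := by
      rw [hM] at hle
      exact_mod_cast hle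
    rcases hMN.lt_or_eq with hlt | rfl
    · exact absurd ((kuRank_le_iff hL2 M).1 hM.le)
        (not_isRatioOfDegreeLE_of_isCoprime hB0 hAB hdeg hlt hU)
    · exact hM

end
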